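/- Let G be a Garside group of finite type and x ∈ G. There is a unique positive element c(x) (possibly trivial) satisfying: (1) x^{c(x)} ∈ SC(x); (2) c(x) ⪯ α for every positive α ∈ G satisfying x^α ∈ SC(x). -/

import Mathlib

/-- A Garside structure of finite type on a group `G`: a submonoid `P` of positive
elements with `P ∩ P⁻¹ = {1}`, such that the prefix order `a ⪯ b ↔ a⁻¹ * b ∈ P` is a
lattice order (with meet `wedge` and join `vee`), together with a Garside element `Δ ∈ P`
whose set of prefixes (the simple elements) is finite and generates `G`, satisfying
`Δ⁻¹ P Δ = P`, and such that every nontrivial positive element has a finite norm. -/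
structure GarsideStructure (G : Type*) [Group G] where
  P : Set G
  one_mem : (1 : G) ∈ P
  mul_mem : ∀ {a b : G}, a ∈ P → b ∈ P → a * b ∈ P
  eq_one_of_mem_of_inv_mem : ∀ a : G, a ∈ P → a⁻¹ ∈ P → a = 1
  wedge : G → G → G
  vee : G → G → G
  wedge_le_left : ∀ a b : G, (wedge a b)⁻¹ * a ∈ P
  wedge_le_right : ∀ a b : G, (wedge a b)⁻¹ * b ∈ P
  le_wedge : ∀ a b c : G, c⁻¹ * a ∈ P → c⁻¹ * b ∈ P → c⁻¹ * wedge a b ∈ P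
  le_vee_left : ∀ a b : G, a⁻¹ * vee a b ∈ P
  le_vee_right : ∀ a b : G, b⁻¹ * vee a b ∈ P
  vee_le : ∀ a b c : G, a⁻¹ * c ∈ P → b⁻¹ * c ∈ P → (vee a b)⁻¹ * c ∈ P
  Δ : G
  Δ_mem : Δ ∈ P
  simples_finite : {s : G | s ∈ P ∧ s⁻¹ * Δ ∈ P}.Finite
  simples_generate : Subgroup.closure {s : G | s ∈ P ∧ s⁻¹ * Δ ∈ P} = (⊤ : Subgroup G)
  conj_Delta_mem : ∀ a : G, a ∈ P → Δ⁻¹ * a * Δ ∈ P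
  mem_of_conj_Delta_mem : ∀ a : G, Δ⁻¹ * a * Δ ∈ P → a ∈ P
  norm_bounded : ∀ x : G, x ∈ P → x ≠ 1 →
    ∃ n : ℕ, ∀ L : List G, (∀ a ∈ L, a ∈ P ∧ a ≠ 1) → L.prod = x → L.length ≤ n

namespace GarsideStructure

variable {G : Type*} [Group G] (gs : GarsideStructure G)

/-- The prefix order: `a ⪯ b`. -/
def pre (a b : G) : Prop := a⁻¹ * b ∈ gs.P

/-- The suffix order: `a ≽ b` (i.e. `b` is a suffix of `a`). -/
def rdvd (a b : G) : Prop := a * b⁻¹ ∈ gs.P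

/-- Greatest common divisor with respect to the suffix order `≽` : `a ∧↰ b`. -/
def rwedge (a b : G) : G := (gs.vee a⁻¹ b⁻¹)⁻¹

/-- Least common multiple with respect to the suffix order `≽` : `a ∨↰ b`. -/
def rvee (a b : G) : G := (gs.wedge a⁻¹ b⁻¹)⁻¹

/-- Simple elements: positive prefixes of `Δ`. -/
def simple (s : G) : Prop := s ∈ gs.P ∧ s⁻¹ * gs.Δ ∈ gs.P

/-- Atoms: nontrivial positive elements which cannot be decomposed in `P`. -/
def atom (a : G) : Prop := a ∈ gs.P ∧ a ≠ 1 ∧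
  ∀ b c : G, b ∈ gs.P → c ∈ gs.P → a = b * c → b = 1 ∨ c = 1

/-- `inf x` : the maximal integer `p` with `Δ^p ⪯ x`. -/
noncomputable def ginf (x : G) : ℤ := sSup {p : ℤ | gs.pre (gs.Δ ^ p) x}

/-- `sup x` : the minimal integer `p` with `x ⪯ Δ^p`. -/
noncomputable def gsup (x : G) : ℤ := sInf {p : ℤ | gs.pre x (gs.Δ ^ p)}

/-- Canonical length `ℓ(x) = sup(x) - inf(x)`. -/
noncomputable def glen (x : G) : ℤ := gs.gsup x - gs.ginf x

/-- `‖x‖` : the maximal number of factors in a decomposition of `x` as a product of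
nontrivial positive elements. -/
noncomputable def gnorm (x : G) : ℕ :=
  sSup {k : ℕ | ∃ L : List G, (∀ a ∈ L, a ∈ gs.P ∧ a ≠ 1) ∧ L.prod = x ∧ L.length = k}

/-- The summit infimum `inf_s(x)` : the maximum of `inf` over the conjugacy class of `x`. -/
noncomputable def ginfs (x : G) : ℤ :=
  sSup {p : ℤ | ∃ y : G, (∃ α : G, α⁻¹ * x * α = y) ∧ p = gs.ginf y}

/-- The summit supremum `sup_s(x)` : the minimum of `sup` over the conjugacy class of `x`. -/
noncomputable def gsups (x : G) : ℤ :=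
  sInf {p : ℤ | ∃ y : G, (∃ α : G, α⁻¹ * x * α = y) ∧ p = gs.gsup y}

/-- The preferred prefix `𝔭(x) = (xΔ^{-inf x}) ∧ (x⁻¹Δ^{sup x}) ∧ Δ`. -/
noncomputable def pp (x : G) : G :=
  gs.wedge (gs.wedge (x * gs.Δ ^ (-gs.ginf x)) (x⁻¹ * gs.Δ ^ gs.gsup x)) gs.Δ

/-- Cyclic (left) sliding `𝔰(x) = 𝔭(x)⁻¹ x 𝔭(x)`. -/
noncomputable def sl (x : G) : G := (gs.pp x)⁻¹ * x * gs.pp x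

/-- The preferred suffix `𝔭↰(x) = (Δ^{-inf x}x) ∧↰ (Δ^{sup x}x⁻¹) ∧↰ Δ`. -/
noncomputable def ps (x : G) : G :=
  gs.rwedge (gs.rwedge (gs.Δ ^ (-gs.ginf x) * x) (gs.Δ ^ gs.gsup x * x⁻¹)) gs.Δ

/-- Cyclic right sliding `𝔰↰(x) = 𝔭↰(x) x 𝔭↰(x)⁻¹`. -/
noncomputable def rsl (x : G) : G := gs.ps x * x * (gs.ps x)⁻¹

/-- The super summit set `SSS(x)` : conjugates of `x` with maximal infimum and minimal
supremum among all conjugates of `x`. -/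
def SSS (x : G) : Set G :=
  {y | (∃ α : G, α⁻¹ * x * α = y) ∧
    ∀ z : G, (∃ α : G, α⁻¹ * x * α = z) → gs.ginf z ≤ gs.ginf y ∧ gs.gsup y ≤ gs.gsup z}

/-- The set of sliding circuits `SC(x)` : conjugates `y` of `x` with `𝔰^m(y) = y` for
some `m ≥ 1`. -/
noncomputable def SC (x : G) : Set G :=
  {y | (∃ α : G, α⁻¹ * x * α = y) ∧ ∃ m : ℕ, 1 ≤ m ∧ (gs.sl)^[m] y = y}

/-- The transport `α^{(1)} = 𝔭(x)⁻¹ α 𝔭(x^α)` of `α` at `x`. -/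
noncomputable def transport (x α : G) : G := (gs.pp x)⁻¹ * α * gs.pp (α⁻¹ * x * α)

/-- Iterated transport `α^{(i)}` of `α` at `x`: `α^{(0)} = α` and `α^{(i+1)}` is the
transport of `α^{(i)}` at `𝔰^i(x)`. -/
noncomputable def transportIter (x α : G) : ℕ → G
  | 0 => α
  | i + 1 => gs.transport ((gs.sl)^[i] x) (transportIter x α i)

/-- `c` is the `⪯`-minimal element `c_s(y)` satisfying `s ⪯ c` and `y^c ∈ SC(x)`. -/
def IsMinSCConj (x y s c : G) : Prop :=
  gs.pre s c ∧ (c⁻¹ * y * c) ∈ gs.SC x ∧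
    ∀ d : G, gs.pre s d → (d⁻¹ * y * d) ∈ gs.SC x → gs.pre c d

/-- `s` is an indecomposable conjugator starting at `u`: `u^s ∈ SC(x)`, `s ≠ 1` and there
is no `t` with `1 ≺ t ≺ s` and `u^t ∈ SC(x)`. -/
def IsIndecomposableConjugator (x u s : G) : Prop :=
  (s⁻¹ * u * s) ∈ gs.SC x ∧ s ≠ 1 ∧
    ¬ ∃ t : G, (gs.pre 1 t ∧ t ≠ 1) ∧ (gs.pre t s ∧ t ≠ s) ∧ (t⁻¹ * u * t) ∈ gs.SC x

/-- `u` is the pullback of `s` at `y = 𝔰(z)` : the `⪯`-minimal positive element with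
`z^u ∈ SSS(x)` and `s ⪯ u^{(1)}` (transport at `z`). -/
def IsPullback (x z s u : G) : Prop :=
  u ∈ gs.P ∧ (u⁻¹ * z * u) ∈ gs.SSS x ∧ gs.pre s (gs.transport z u) ∧
    ∀ u' : G, u' ∈ gs.P → (u'⁻¹ * z * u') ∈ gs.SSS x → gs.pre s (gs.transport z u') →
      gs.pre u u'

/-- The pullback `s_{(1)}` of `s` at `y = 𝔰(z)`. -/
noncomputable def pullbackOne (x z s : G) : G :=
  @Classical.epsilon G ⟨1⟩ (fun u => gs.IsPullback x z s u)

/-- The `k`-fold pullback `s_{(k)}` of `s` at `y = 𝔰^k(z)` (an element at `z`):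
`s_{(0)} = s` and `s_{(k+1)}` is the pullback at `𝔰(z)` (relative to `z`) of the `k`-fold
pullback of `s` at `𝔰^k(𝔰(z)) = y`. -/
noncomputable def pullbackIter (x : G) : G → ℕ → G → G
  | _, 0, s => s
  | z, k + 1, s => gs.pullbackOne x z (pullbackIter x (gs.sl z) k s)

end GarsideStructure

open GarsideStructure

variable {G : Type*} [Group G]

section CommutingIsos

variable {L : Type*} [SemilatticeInf L]

/-- The orbit of `e` under `A ⊓ D`, renormalised by powers of `D`, is decreasing; once it
stabilises, `D` lies below `A`. -/
theorem exists_iterate_inf_le (A D : L ≃o L) (hAD : ∀ a, A (D a) = D (A a)) {e α : L}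
    (hα : α ≤ e) (hαA : D α ≤ A α) (hfin : (Set.Icc α e).Finite) :
    ∃ k : ℕ, D ((fun a => A a ⊓ D a)^[k] e) ≤ A ((fun a => A a ⊓ D a)^[k] e) := by
  set f : L → L := fun a => A a ⊓ D a with hf
  have hmono : Monotone f := fun a b h =>
    inf_le_inf (A.monotone h) (D.monotone h)
  have hcomm : Function.Commute f D := fun a => by simp [hf, hAD]
  have hfα : f α = D α := inf_eq_right.2 hαA
  have hiter : ∀ k : ℕ, f^[k] α = D^[k] α := by
    intro k
    induction k with
    | zero => rfl
    | succ k ih =>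
      rw [Function.iterate_succ_apply', ih, (hcomm.iterate_right k) α, hfα,
        ← Function.iterate_succ_apply]
  have hsymm : ∀ k : ℕ, ∀ a, D.symm^[k] (D^[k] a) = a := fun k a =>
    (Function.LeftInverse.iterate D.symm_apply_apply k) a
  set c : ℕ → L := fun k => D.symm^[k] (f^[k] e) with hc
  have hstep : ∀ k, D.symm (f^[k + 1] e) ≤ f^[k] e := by
    intro k
    rw [OrderIso.symm_apply_le, Function.iterate_succ_apply']
    exact inf_le_right
  have hanti : ∀ k, c (k + 1) ≤ c k := by
    intro k
    simp only [hc]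
    rw [Function.iterate_succ_apply D.symm]
    exact D.symm.monotone.iterate k (hstep k)
  have hanti' : Antitone c := antitone_nat_of_succ_le hanti
  have hmem : ∀ k, c k ∈ Set.Icc α e := by
    intro k
    refine ⟨?_, hanti' (Nat.zero_le k)⟩
    have h1 : D^[k] α ≤ f^[k] e := by
      rw [← hiter]
      exact hmono.iterate k hα
    have h2 := D.symm.monotone.iterate k h1
    rwa [hsymm] at h2
  obtain ⟨k, hk⟩ : ∃ k, c (k + 1) = c k := by
    by_contra! hne
    have hs : StrictAnti c := strictAnti_nat_of_succ_lt fun k => lt_of_le_of_ne (hanti k) (hne k)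
    exact Set.infinite_of_injective_forall_mem hs.injective hmem hfin
  refine ⟨k, ?_⟩
  have h1 : D.symm (f^[k + 1] e) = f^[k] e := by
    simp only [hc] at hk
    rw [Function.iterate_succ_apply D.symm] at hk
    exact D.symm.injective.iterate k hk
  have h2 : D (f^[k] e) = f (f^[k] e) := by
    rw [← Function.iterate_succ_apply' f]
    exact ((D.symm_apply_eq).1 h1).symm
  rw [h2]
  exact inf_le_left

/-- If `D ∘ D ≤ A ∘ B`, iterating `A ⊓ B ⊓ D` reaches a point where `D` lies below `A`
as soon as iterating `A ⊓ D` does. -/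
theorem le_iterate_inf_inf (A B D : L ≃o L) (hAB : ∀ a, A (B a) = B (A a))
    (hAD : ∀ a, A (D a) = D (A a)) (hBD : ∀ a, B (D a) = D (B a))
    (hD : ∀ a, D (D a) ≤ A (B a)) {e : L} {k : ℕ}
    (hk : D ((fun a => A a ⊓ D a)^[k] e) ≤ A ((fun a => A a ⊓ D a)^[k] e)) :
    D ((fun a => A a ⊓ B a ⊓ D a)^[k] e) ≤ A ((fun a => A a ⊓ B a ⊓ D a)^[k] e) := by
  set C : ℕ → L := fun k => (fun a => A a ⊓ D a)^[k] e with hC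
  set E : ℕ → L := fun k => (fun a => B a ⊓ D a)^[k] e with hE
  have C0 : C 0 = e := rfl
  have E0 : E 0 = e := rfl
  have Cs : ∀ k, C (k + 1) = A (C k) ⊓ D (C k) := fun k => Function.iterate_succ_apply' _ _ _
  have Es : ∀ k, E (k + 1) = B (E k) ⊓ D (E k) := fun k => Function.iterate_succ_apply' _ _ _
  have CD : ∀ k, C (k + 1) ≤ D (C k) := fun k => (Cs k).le.trans inf_le_right
  have ED : ∀ k, E (k + 1) ≤ D (E k) := fun k => (Es k).le.trans inf_le_right
  have hBC : ∀ k, C (k + 1) ⊓ E (k + 1) ≤ B (C k) := by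
    intro k
    induction k with
    | zero =>
      rw [C0, Es 0, E0]
      exact inf_le_right.trans inf_le_left
    | succ k ih =>
      rw [Cs k, map_inf, ← hAB, hBD]
      refine le_inf ?_ ?_
      · exact inf_le_left.trans ((CD _).trans ((D.monotone (CD k)).trans (hD _)))
      · refine le_trans ?_ (D.monotone ih)
        rw [map_inf]
        exact inf_le_inf (CD _) (ED _)
  have hAE : ∀ k, C (k + 1) ⊓ E (k + 1) ≤ A (E k) := by
    intro k
    induction k with
    | zero =>
      rw [Cs 0, E0, C0]
      exact inf_le_left.trans inf_le_left
    | succ k ih =>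
      rw [Es k, map_inf, hAD]
      refine le_inf ?_ ?_
      · exact inf_le_right.trans ((ED _).trans ((D.monotone (ED k)).trans (hD _)))
      · refine le_trans ?_ (D.monotone ih)
        rw [map_inf]
        exact inf_le_inf (CD _) (ED _)
  have hM : ∀ k, (fun a => A a ⊓ B a ⊓ D a)^[k] e = C k ⊓ E k := by
    intro k
    induction k with
    | zero => simp [C0, E0]
    | succ k ih =>
      rw [Function.iterate_succ_apply', ih]
      simp only [map_inf]
      apply le_antisymm
      · rw [Cs, Es]
        refine le_inf (le_inf ?_ ?_) (le_inf ?_ ?_)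
        · exact inf_le_left.trans (inf_le_left.trans inf_le_left)
        · exact inf_le_right.trans inf_le_left
        · exact inf_le_left.trans (inf_le_right.trans inf_le_right)
        · exact inf_le_right.trans inf_le_right
      · refine le_inf (le_inf (le_inf ?_ (hAE k)) (le_inf (hBC k) ?_)) (le_inf ?_ ?_)
        · rw [Cs]; exact inf_le_left.trans inf_le_left
        · rw [Es]; exact inf_le_right.trans inf_le_left
        · exact inf_le_left.trans (CD k)
        · exact inf_le_right.trans (ED k)
  rw [hM, map_inf, map_inf]
  refine le_inf (inf_le_left.trans hk) ?_
  cases k with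
  | zero =>
    rw [E0]
    exact inf_le_left.trans hk
  | succ k =>
    have hAEs : A (E (k + 1)) = A (B (E k)) ⊓ D (A (E k)) := by rw [Es k, map_inf, hAD]
    rw [hAEs]
    refine le_inf ?_ ?_
    · exact inf_le_right.trans ((D.monotone (ED k)).trans (hD _))
    · rw [← map_inf]
      exact D.monotone (hAE k)

theorem exists_iterate_inf_inf_le (A B D : L ≃o L) (hAB : ∀ a, A (B a) = B (A a))
    (hAD : ∀ a, A (D a) = D (A a)) (hBD : ∀ a, B (D a) = D (B a)) {e α : L}
    (hD : (∀ a, D (D a) ≤ A (B a)) ∨ A e ≤ D e)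
    (hα : α ≤ e) (hαA : D α ≤ A α) (hfin : (Set.Icc α e).Finite) :
    ∃ k : ℕ, D ((fun a => A a ⊓ B a ⊓ D a)^[k] e) ≤ A ((fun a => A a ⊓ B a ⊓ D a)^[k] e) := by
  obtain ⟨k, hk⟩ := exists_iterate_inf_le A D hAD hα hαA hfin
  rcases hD with hD | hD
  · exact ⟨k, le_iterate_inf_inf A B D hAB hAD hBD hD hk⟩
  · refine ⟨0, ?_⟩
    have hcomm : Function.Commute A D := hAD
    have hiter : (fun a => A a ⊓ D a)^[k] e = A^[k] e := by
      have h : Function.Commute (fun a => A a ⊓ D a) A := fun a => by simp [hAD]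
      clear hk
      induction k with
      | zero => rfl
      | succ k ih =>
        rw [Function.iterate_succ_apply', ih, Function.iterate_succ_apply A]
        exact ((h.iterate_right k) e).trans (congrArg _ (inf_eq_left.2 hD))
    rw [hiter, ← Function.iterate_succ_apply' A, ← (hcomm.iterate_left k) e,
      Function.iterate_succ_apply A] at hk
    have hle : ∀ (n : ℕ) (a b : L), A^[n] a ≤ A^[n] b → a ≤ b := by
      intro n
      induction n with
      | zero => exact fun a b h => h
      | succ n ih =>
        intro a b h
        rw [Function.iterate_succ_apply, Function.iterate_succ_apply] at h
        exact A.le_iff_le.1 (ih _ _ h)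
    exact hle k _ _ hk

end CommutingIsos

namespace GarsideStructure

section Order

variable (gs : GarsideStructure G)

theorem conj_zpow_mem {a : G} (ha : a ∈ gs.P) (n : ℤ) : gs.Δ ^ (-n) * a * gs.Δ ^ n ∈ gs.P := by
  induction n using Int.induction_on with
  | zero => simpa using ha
  | succ n ih =>
    have h := gs.conj_Delta_mem _ ih
    convert h using 1
    group
  | pred n ih =>
    apply gs.mem_of_conj_Delta_mem
    convert ih using 1
    group

theorem pow_Δ_mem (n : ℕ) : gs.Δ ^ n ∈ gs.P := by
  induction n with
  | zero => simpa using gs.one_mem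
  | succ n ih => rw [pow_succ]; exact gs.mul_mem ih gs.Δ_mem

theorem pre_refl (a : G) : gs.pre a a := by
  simpa [pre] using gs.one_mem

theorem pre_trans {a b c : G} (h : gs.pre a b) (h' : gs.pre b c) : gs.pre a c := by
  have := gs.mul_mem h h'
  simpa [pre, mul_assoc] using this

theorem pre_antisymm {a b : G} (h : gs.pre a b) (h' : gs.pre b a) : a = b := by
  have := gs.eq_one_of_mem_of_inv_mem _ h (by simpa [pre] using h')
  exact (inv_mul_eq_one.1 this)

theorem pre_one {a : G} : gs.pre 1 a ↔ a ∈ gs.P := by simp [pre]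

/-- The prefix order as a meet-semilattice. -/
@[reducible] def semilatticeInf : SemilatticeInf G where
  le := gs.pre
  le_refl := gs.pre_refl
  le_trans _ _ _ := gs.pre_trans
  le_antisymm _ _ := gs.pre_antisymm
  inf := gs.wedge
  inf_le_left := gs.wedge_le_left
  inf_le_right := gs.wedge_le_right
  le_inf c a b := gs.le_wedge a b c

theorem pre_mul_left (x : G) {a b : G} : gs.pre (x * a) (x * b) ↔ gs.pre a b := by
  simp [pre, mul_assoc]

theorem pre_mul_zpow (n : ℤ) {a b : G} : gs.pre (a * gs.Δ ^ n) (b * gs.Δ ^ n) ↔ gs.pre a b := by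
  constructor
  · intro h
    have := gs.conj_zpow_mem h (-n)
    unfold pre
    convert this using 1
    group
  · intro h
    have := gs.conj_zpow_mem h n
    unfold pre
    convert this using 1
    group

/-- The order automorphism `a ↦ x * a * Δ ^ n`. -/
def twist (x : G) (n : ℤ) :
    letI := gs.semilatticeInf
    G ≃o G :=
  letI := gs.semilatticeInf
  { toFun := fun a => x * a * gs.Δ ^ n
    invFun := fun a => x⁻¹ * a * gs.Δ ^ (-n)
    left_inv := fun a => by simp [mul_assoc]
    right_inv := fun a => by simp [mul_assoc]
    map_rel_iff' := (gs.pre_mul_zpow n).trans (gs.pre_mul_left x) }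

theorem twist_wedge (x : G) (n : ℤ) (a b : G) :
    x * gs.wedge a b * gs.Δ ^ n = gs.wedge (x * a * gs.Δ ^ n) (x * b * gs.Δ ^ n) :=
  letI := gs.semilatticeInf
  map_inf (gs.twist x n) a b

theorem mul_wedge (x a b : G) : x * gs.wedge a b = gs.wedge (x * a) (x * b) := by
  simpa using gs.twist_wedge x 0 a b

theorem wedge_mul_zpow (a b : G) (n : ℤ) :
    gs.wedge a b * gs.Δ ^ n = gs.wedge (a * gs.Δ ^ n) (b * gs.Δ ^ n) := by
  simpa using gs.twist_wedge 1 n a b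

theorem exists_zpow_bounds (x : G) :
    ∃ n : ℕ, gs.pre (gs.Δ ^ (-(n : ℤ))) x ∧ gs.pre x (gs.Δ ^ (n : ℤ)) := by
  have hx : x ∈ Subgroup.closure {s : G | s ∈ gs.P ∧ s⁻¹ * gs.Δ ∈ gs.P} := by
    rw [gs.simples_generate]; trivial
  unfold pre
  induction hx using Subgroup.closure_induction with
  | mem s hs =>
    refine ⟨1, ?_, ?_⟩
    · simpa using gs.mul_mem gs.Δ_mem hs.1
    · simpa using hs.2
  | one => exact ⟨0, by simpa using gs.one_mem, by simpa using gs.one_mem⟩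
  | mul x y _ _ hx hy =>
    obtain ⟨n, hn, hn'⟩ := hx
    obtain ⟨m, hm, hm'⟩ := hy
    refine ⟨n + m, ?_, ?_⟩
    · have := gs.mul_mem (gs.conj_zpow_mem hn (-m)) hm
      push_cast
      convert this using 1
      group
    · have := gs.mul_mem hm' (gs.conj_zpow_mem hn' m)
      push_cast
      convert this using 1
      group
  | inv x _ hx =>
    obtain ⟨n, hn, hn'⟩ := hx
    refine ⟨n, ?_, ?_⟩
    · have := gs.conj_zpow_mem hn' (-n)
      convert this using 1
      group
    · have := gs.conj_zpow_mem hn n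
      convert this using 1
      group

theorem finite_interval_one_pow (n : ℕ) :
    {a : G | a ∈ gs.P ∧ gs.pre a (gs.Δ ^ n)}.Finite := by
  induction n with
  | zero =>
    refine (Set.finite_singleton (1 : G)).subset fun a ha => ?_
    exact gs.eq_one_of_mem_of_inv_mem a ha.1 (by simpa [pre] using ha.2)
  | succ n ih =>
    refine (gs.simples_finite.image2 (· * ·) ih).subset fun a ha => ?_
    refine ⟨gs.wedge a gs.Δ, ⟨?_, gs.wedge_le_right _ _⟩, (gs.wedge a gs.Δ)⁻¹ * a,
      ⟨gs.wedge_le_left _ _, ?_⟩, by simp⟩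
    · have := gs.le_wedge a gs.Δ 1 (by simpa using ha.1) (by simpa using gs.Δ_mem)
      simpa using this
    · rw [← gs.pre_mul_left (gs.wedge a gs.Δ)]
      have h := gs.wedge_mul_zpow a gs.Δ n
      simp only [zpow_natCast] at h
      rw [h, mul_inv_cancel_left]
      refine gs.le_wedge _ _ _ ?_ ?_
      · simpa using gs.pow_Δ_mem n
      · rw [← pow_succ']
        exact ha.2

theorem finite_interval (a b : G) : {c : G | gs.pre a c ∧ gs.pre c b}.Finite := by
  obtain ⟨n, -, hn⟩ := gs.exists_zpow_bounds (a⁻¹ * b)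
  refine ((gs.finite_interval_one_pow n).image (a * ·)).subset fun c hc => ?_
  refine ⟨a⁻¹ * c, ⟨hc.1, ?_⟩, by simp⟩
  rw [zpow_natCast] at hn
  exact gs.pre_trans ((gs.pre_mul_left a⁻¹).2 hc.2) hn

theorem subsingleton_of_Δ_eq_one (h : gs.Δ = 1) : Subsingleton G := by
  refine subsingleton_of_forall_eq 1 fun x => ?_
  obtain ⟨n, hn, hn'⟩ := gs.exists_zpow_bounds x
  simp only [h, one_zpow] at hn hn'
  exact gs.pre_antisymm hn' hn

theorem zpow_Δ_pre_zpow_Δ (hΔ : gs.Δ ≠ 1) {m n : ℤ} : gs.pre (gs.Δ ^ m) (gs.Δ ^ n) ↔ m ≤ n := by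
  constructor
  · intro h
    by_contra! hlt
    obtain ⟨k, hk⟩ : ∃ k : ℕ, m = n + (k + 1) :=
      ⟨(m - n - 1).toNat, by omega⟩
    apply hΔ
    refine gs.eq_one_of_mem_of_inv_mem _ gs.Δ_mem ?_
    have := gs.mul_mem h (gs.pow_Δ_mem k)
    rw [hk] at this
    convert this using 1
    group
  · intro h
    obtain ⟨k, hk⟩ := Int.le.dest h
    unfold pre
    rw [← hk]
    convert gs.pow_Δ_mem k using 1
    group

theorem le_ginf (hΔ : gs.Δ ≠ 1) {p : ℤ} {x : G} : p ≤ gs.ginf x ↔ gs.pre (gs.Δ ^ p) x := by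
  obtain ⟨n, hn, hn'⟩ := gs.exists_zpow_bounds x
  have hne : {p : ℤ | gs.pre (gs.Δ ^ p) x}.Nonempty := ⟨_, hn⟩
  have hbdd : BddAbove {p : ℤ | gs.pre (gs.Δ ^ p) x} :=
    ⟨n, fun p hp => (gs.zpow_Δ_pre_zpow_Δ hΔ).1 (gs.pre_trans hp hn')⟩
  constructor
  · intro h
    exact gs.pre_trans ((gs.zpow_Δ_pre_zpow_Δ hΔ).2 h) (Int.csSup_mem hne hbdd)
  · intro h
    exact le_csSup hbdd h

theorem gsup_le (hΔ : gs.Δ ≠ 1) {p : ℤ} {x : G} : gs.gsup x ≤ p ↔ gs.pre x (gs.Δ ^ p) := by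
  obtain ⟨n, hn, hn'⟩ := gs.exists_zpow_bounds x
  have hne : {p : ℤ | gs.pre x (gs.Δ ^ p)}.Nonempty := ⟨_, hn'⟩
  have hbdd : BddBelow {p : ℤ | gs.pre x (gs.Δ ^ p)} :=
    ⟨-n, fun p hp => (gs.zpow_Δ_pre_zpow_Δ hΔ).1 (gs.pre_trans hn hp)⟩
  constructor
  · intro h
    exact gs.pre_trans (Int.csInf_mem hne hbdd) ((gs.zpow_Δ_pre_zpow_Δ hΔ).2 h)
  · intro h
    exact csInf_le hbdd h

theorem le_ginf_conj (hΔ : gs.Δ ≠ 1) {p : ℤ} {x γ : G} :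
    p ≤ gs.ginf (γ⁻¹ * x * γ) ↔ gs.pre γ (x * γ * gs.Δ ^ (-p)) := by
  rw [gs.le_ginf hΔ, ← gs.pre_mul_zpow p (b := x * γ * gs.Δ ^ (-p)),
    ← gs.pre_mul_left γ]
  simp [mul_assoc]

theorem gsup_conj_le (hΔ : gs.Δ ≠ 1) {q : ℤ} {x γ : G} :
    gs.gsup (γ⁻¹ * x * γ) ≤ q ↔ gs.pre γ (x⁻¹ * γ * gs.Δ ^ q) := by
  rw [gs.gsup_le hΔ]
  simp [pre, mul_assoc]

theorem pre_twist_wedge {x a b : G} {n : ℤ} (ha : gs.pre a (x * a * gs.Δ ^ n))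
    (hb : gs.pre b (x * b * gs.Δ ^ n)) :
    gs.pre (gs.wedge a b) (x * gs.wedge a b * gs.Δ ^ n) := by
  rw [gs.twist_wedge]
  exact gs.le_wedge _ _ _ (gs.pre_trans (gs.wedge_le_left a b) ha)
    (gs.pre_trans (gs.wedge_le_right a b) hb)

theorem le_ginf_conj_wedge (hΔ : gs.Δ ≠ 1) {p : ℤ} {x a b : G}
    (ha : p ≤ gs.ginf (a⁻¹ * x * a)) (hb : p ≤ gs.ginf (b⁻¹ * x * b)) :
    p ≤ gs.ginf ((gs.wedge a b)⁻¹ * x * gs.wedge a b) := by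
  rw [gs.le_ginf_conj hΔ] at *
  exact gs.pre_twist_wedge ha hb

theorem gsup_conj_wedge_le (hΔ : gs.Δ ≠ 1) {q : ℤ} {x a b : G}
    (ha : gs.gsup (a⁻¹ * x * a) ≤ q) (hb : gs.gsup (b⁻¹ * x * b) ≤ q) :
    gs.gsup ((gs.wedge a b)⁻¹ * x * gs.wedge a b) ≤ q := by
  rw [gs.gsup_conj_le hΔ] at *
  exact gs.pre_twist_wedge ha hb

theorem ginf_le_ginf_conj_zpow (hΔ : gs.Δ ≠ 1) (x : G) (n : ℤ) :
    gs.ginf x ≤ gs.ginf ((gs.Δ ^ n)⁻¹ * x * gs.Δ ^ n) := by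
  rw [gs.le_ginf hΔ]
  have h := gs.conj_zpow_mem ((gs.le_ginf hΔ).1 le_rfl : gs.pre (gs.Δ ^ gs.ginf x) x) n
  unfold pre
  convert h using 1
  group

theorem gsup_conj_zpow_le (hΔ : gs.Δ ≠ 1) (x : G) (n : ℤ) :
    gs.gsup ((gs.Δ ^ n)⁻¹ * x * gs.Δ ^ n) ≤ gs.gsup x := by
  rw [gs.gsup_le hΔ]
  have h := gs.conj_zpow_mem ((gs.gsup_le hΔ).1 le_rfl : gs.pre x (gs.Δ ^ gs.gsup x)) n
  unfold pre
  convert h using 1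
  group

theorem ginf_le_ginf_sl (hΔ : gs.Δ ≠ 1) (x : G) : gs.ginf x ≤ gs.ginf (gs.sl x) := by
  refine gs.le_ginf_conj_wedge hΔ (gs.le_ginf_conj_wedge hΔ ?_ ?_) ?_
  · simpa [mul_assoc] using gs.ginf_le_ginf_conj_zpow hΔ x (-gs.ginf x)
  · simpa [mul_assoc] using gs.ginf_le_ginf_conj_zpow hΔ x (gs.gsup x)
  · simpa using gs.ginf_le_ginf_conj_zpow hΔ x 1

theorem gsup_sl_le (hΔ : gs.Δ ≠ 1) (x : G) : gs.gsup (gs.sl x) ≤ gs.gsup x := by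
  refine gs.gsup_conj_wedge_le hΔ (gs.gsup_conj_wedge_le hΔ ?_ ?_) ?_
  · simpa [mul_assoc] using gs.gsup_conj_zpow_le hΔ x (-gs.ginf x)
  · simpa [mul_assoc] using gs.gsup_conj_zpow_le hΔ x (gs.gsup x)
  · simpa using gs.gsup_conj_zpow_le hΔ x 1

theorem pp_mem (hΔ : gs.Δ ≠ 1) (x : G) : gs.pp x ∈ gs.P := by
  rw [← gs.pre_one]
  refine gs.le_wedge _ _ _ (gs.le_wedge _ _ _ ?_ ?_) (gs.pre_one.2 gs.Δ_mem)
  · have := (gs.le_ginf_conj hΔ (p := gs.ginf x) (x := x) (γ := 1)).1 (by simp)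
    simpa [pre] using this
  · have := (gs.gsup_conj_le hΔ (q := gs.gsup x) (x := x) (γ := 1)).1 (by simp)
    simpa [pre] using this

end Order

section Sliding

variable (gs : GarsideStructure G)

theorem exists_mem_iterate_sl (hΔ : gs.Δ ≠ 1) (x : G) (k : ℕ) :
    ∃ c ∈ gs.P, c⁻¹ * x * c = gs.sl^[k] x := by
  induction k with
  | zero => exact ⟨1, gs.one_mem, by simp⟩
  | succ k ih =>
    obtain ⟨c, hc, h⟩ := ih
    refine ⟨c * gs.pp (gs.sl^[k] x), gs.mul_mem hc (gs.pp_mem hΔ _), ?_⟩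
    rw [Function.iterate_succ_apply', sl, ← h]
    group

theorem monotone_ginf_iterate_sl (hΔ : gs.Δ ≠ 1) (x : G) :
    Monotone fun k => gs.ginf (gs.sl^[k] x) :=
  monotone_nat_of_le_succ fun k => by
    rw [Function.iterate_succ_apply']
    exact gs.ginf_le_ginf_sl hΔ _

theorem antitone_gsup_iterate_sl (hΔ : gs.Δ ≠ 1) (x : G) :
    Antitone fun k => gs.gsup (gs.sl^[k] x) :=
  antitone_nat_of_succ_le fun k => by
    rw [Function.iterate_succ_apply']
    exact gs.gsup_sl_le hΔ _

theorem ginf_iterate_sl_eq (hΔ : gs.Δ ≠ 1) {x : G} {m : ℕ} (hm : 1 ≤ m) (hx : gs.sl^[m] x = x)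
    (k : ℕ) : gs.ginf (gs.sl^[k] x) = gs.ginf x := by
  refine le_antisymm ?_ (gs.monotone_ginf_iterate_sl hΔ x (Nat.zero_le k))
  have h := gs.monotone_ginf_iterate_sl hΔ x (Nat.le_mul_of_pos_left k hm)
  have h' : gs.sl^[m * k] x = x := by
    rw [Function.iterate_mul]
    exact Function.iterate_fixed hx k
  simpa only [h'] using h

theorem gsup_iterate_sl_eq (hΔ : gs.Δ ≠ 1) {x : G} {m : ℕ} (hm : 1 ≤ m) (hx : gs.sl^[m] x = x)
    (k : ℕ) : gs.gsup (gs.sl^[k] x) = gs.gsup x := by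
  refine le_antisymm (gs.antitone_gsup_iterate_sl hΔ x (Nat.zero_le k)) ?_
  have h := gs.antitone_gsup_iterate_sl hΔ x (Nat.le_mul_of_pos_left k hm)
  have h' : gs.sl^[m * k] x = x := by
    rw [Function.iterate_mul]
    exact Function.iterate_fixed hx k
  simpa only [h'] using h

/-- The meet-homomorphism `γ ↦ γ * 𝔭(x^γ)`, for conjugates `x^γ` of infimum `p` and
supremum `q`. -/
def slideMap (x : G) (p q : ℤ) (γ : G) : G :=
  gs.wedge (gs.wedge (x * γ * gs.Δ ^ (-p)) (x⁻¹ * γ * gs.Δ ^ q)) (1 * γ * gs.Δ ^ (1 : ℤ))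

theorem slideMap_eq {x γ : G} {p q : ℤ} (hp : gs.ginf (γ⁻¹ * x * γ) = p)
    (hq : gs.gsup (γ⁻¹ * x * γ) = q) :
    gs.slideMap x p q γ = γ * gs.pp (γ⁻¹ * x * γ) := by
  rw [pp, hp, hq, gs.mul_wedge, gs.mul_wedge, slideMap]
  simp [mul_assoc]

theorem slideMap_wedge (x : G) (p q : ℤ) (a b : G) :
    gs.slideMap x p q (gs.wedge a b) =
      gs.wedge (gs.slideMap x p q a) (gs.slideMap x p q b) := by
  let := gs.semilatticeInf
  simp only [slideMap, gs.twist_wedge]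
  change (_ ⊓ _) ⊓ (_ ⊓ _) ⊓ (_ ⊓ _) = (_ ⊓ _ ⊓ _) ⊓ (_ ⊓ _ ⊓ _)
  ac_rfl

theorem iterate_slideMap_wedge (x : G) (p q : ℤ) (k : ℕ) (a b : G) :
    (gs.slideMap x p q)^[k] (gs.wedge a b) =
      gs.wedge ((gs.slideMap x p q)^[k] a) ((gs.slideMap x p q)^[k] b) := by
  induction k with
  | zero => rfl
  | succ k ih => simp only [Function.iterate_succ_apply', ih, slideMap_wedge]

theorem iterate_slideMap_mul_zpow (x : G) (p q n : ℤ) (k : ℕ) (a : G) :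
    (gs.slideMap x p q)^[k] (a * gs.Δ ^ n) = (gs.slideMap x p q)^[k] a * gs.Δ ^ n := by
  induction k with
  | zero => rfl
  | succ k ih =>
    simp only [Function.iterate_succ_apply', ih, slideMap, gs.wedge_mul_zpow]
    simp only [mul_assoc, ← zpow_add, add_comm]

theorem conj_iterate_slideMap {x γ : G} {p q : ℤ}
    (hp : ∀ k, gs.ginf (gs.sl^[k] (γ⁻¹ * x * γ)) = p)
    (hq : ∀ k, gs.gsup (gs.sl^[k] (γ⁻¹ * x * γ)) = q) (k : ℕ) :
    ((gs.slideMap x p q)^[k] γ)⁻¹ * x * (gs.slideMap x p q)^[k] γ =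
      gs.sl^[k] (γ⁻¹ * x * γ) := by
  induction k with
  | zero => rfl
  | succ k ih =>
    rw [Function.iterate_succ_apply', Function.iterate_succ_apply',
      gs.slideMap_eq (by rw [ih, hp]) (by rw [ih, hq]), sl, ← ih]
    group

/-- The conjugator taking `y` to `𝔰^k(y)` depends on `y` only. -/
theorem exists_iterate_slideMap_eq {y : G} {p q : ℤ}
    (hp : ∀ k, gs.ginf (gs.sl^[k] y) = p) (hq : ∀ k, gs.gsup (gs.sl^[k] y) = q) (k : ℕ) :
    ∃ v : G, ∀ x γ : G, γ⁻¹ * x * γ = y → (gs.slideMap x p q)^[k] γ = γ * v := by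
  induction k with
  | zero => exact ⟨1, by simp⟩
  | succ k ih =>
    obtain ⟨v, hv⟩ := ih
    refine ⟨v * gs.pp (gs.sl^[k] y), ?_⟩
    rintro x γ rfl
    have h := gs.conj_iterate_slideMap hp hq k
    rw [Function.iterate_succ_apply', gs.slideMap_eq (by rw [h, hp]) (by rw [h, hq]), h,
      hv x γ rfl, mul_assoc]

theorem slideMap_inv (x : G) (p q : ℤ) :
    gs.slideMap x⁻¹ (-q) (-p) = gs.slideMap x p q := by
  let := gs.semilatticeInf
  funext γ
  simp only [slideMap, neg_neg, inv_inv]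
  change (_ ⊓ _) ⊓ _ = (_ ⊓ _) ⊓ _
  ac_rfl

theorem exists_pre_iterate_slideMap {x α : G} {p q : ℤ} (hα : gs.pre α 1)
    (hαA : gs.pre α (x * α * gs.Δ ^ (-(p + 1))))
    (hpq : 2 ≤ q - p ∨ gs.pre (x * gs.Δ ^ (-p)) gs.Δ) :
    ∃ k : ℕ, gs.pre ((gs.slideMap x p q)^[k] 1)
      (x * (gs.slideMap x p q)^[k] 1 * gs.Δ ^ (-(p + 1))) := by
  have key : ∀ γ : G, gs.pre γ (x * γ * gs.Δ ^ (-(p + 1))) ↔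
      gs.pre (1 * γ * gs.Δ ^ (1 : ℤ)) (x * γ * gs.Δ ^ (-p)) := by
    intro γ
    rw [← gs.pre_mul_zpow 1]
    simp only [one_mul, mul_assoc, ← zpow_add]
    rw [neg_add_rev, add_comm (-1 : ℤ), neg_add_cancel_right]
  simp only [key] at hαA ⊢
  let := gs.semilatticeInf
  refine exists_iterate_inf_inf_le (gs.twist x (-p)) (gs.twist x⁻¹ q) (gs.twist 1 1)
    (e := 1) (α := α) ?_ ?_ ?_ ?_ hα hαA (gs.finite_interval α 1)
  · intro a
    change x * (x⁻¹ * a * gs.Δ ^ q) * gs.Δ ^ (-p) = x⁻¹ * (x * a * gs.Δ ^ (-p)) * gs.Δ ^ q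
    group
  · intro a
    change x * (1 * a * gs.Δ ^ (1 : ℤ)) * gs.Δ ^ (-p) = 1 * (x * a * gs.Δ ^ (-p)) * gs.Δ ^ (1 : ℤ)
    group
  · intro a
    change x⁻¹ * (1 * a * gs.Δ ^ (1 : ℤ)) * gs.Δ ^ q = 1 * (x⁻¹ * a * gs.Δ ^ q) * gs.Δ ^ (1 : ℤ)
    group
  · refine hpq.imp (fun h a => ?_) (fun h => ?_)
    · change gs.pre (1 * (1 * a * gs.Δ ^ (1 : ℤ)) * gs.Δ ^ (1 : ℤ))
        (x * (x⁻¹ * a * gs.Δ ^ q) * gs.Δ ^ (-p))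
      obtain ⟨n, hn⟩ := Int.le.dest h
      unfold pre
      convert gs.pow_Δ_mem n using 1
      rw [← zpow_natCast, show (n : ℤ) = q - p - 2 by omega]
      group
    · change gs.pre (x * 1 * gs.Δ ^ (-p)) (1 * 1 * gs.Δ ^ (1 : ℤ))
      simpa using h

theorem exists_conjugator_pre_one (x α : G) :
    ∃ (β : G) (n : ℤ), gs.pre β 1 ∧
      β⁻¹ * x * β = (gs.Δ ^ n)⁻¹ * (α⁻¹ * x * α) * gs.Δ ^ n := by
  obtain ⟨n, -, hn⟩ := gs.exists_zpow_bounds α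
  refine ⟨α * gs.Δ ^ (-(n : ℤ)), -n, ?_, by group⟩
  rw [← gs.pre_mul_zpow n]
  simpa using hn

/-- Elements of sliding circuits have maximal infimum in their conjugacy class. -/
theorem ginf_conj_le_of_periodic (hΔ : gs.Δ ≠ 1) {y : G} {m : ℕ} (hm : 1 ≤ m)
    (hy : gs.sl^[m] y = y) (α : G) : gs.ginf (α⁻¹ * y * α) ≤ gs.ginf y := by
  by_contra! hlt
  obtain ⟨β, n, hβ, hβn⟩ := gs.exists_conjugator_pre_one y α
  have hβA : gs.ginf y + 1 ≤ gs.ginf (β⁻¹ * y * β) := by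
    rw [hβn]
    exact hlt.trans_le (gs.ginf_le_ginf_conj_zpow hΔ _ n)
  rw [gs.le_ginf_conj hΔ] at hβA
  obtain ⟨k, hk⟩ := gs.exists_pre_iterate_slideMap (q := gs.gsup y) hβ hβA (by
    refine (le_or_gt 2 (gs.gsup y - gs.ginf y)).imp_right fun h => ?_
    have h' := (gs.gsup_le hΔ).1 (show gs.gsup y ≤ gs.ginf y + 1 by omega)
    rw [← gs.pre_mul_zpow (-gs.ginf y), ← zpow_add] at h'
    simpa using h')
  rw [← gs.le_ginf_conj hΔ, gs.conj_iterate_slideMap (γ := 1)] at hk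
  · simp only [inv_one, one_mul, mul_one, gs.ginf_iterate_sl_eq hΔ hm hy] at hk
    omega
  · simpa using gs.ginf_iterate_sl_eq hΔ hm hy
  · simpa using gs.gsup_iterate_sl_eq hΔ hm hy

/-- Elements of sliding circuits have minimal supremum in their conjugacy class. -/
theorem le_gsup_conj_of_periodic (hΔ : gs.Δ ≠ 1) {y : G} {m : ℕ} (hm : 1 ≤ m)
    (hy : gs.sl^[m] y = y) (α : G) : gs.gsup y ≤ gs.gsup (α⁻¹ * y * α) := by
  by_contra! hlt
  obtain ⟨β, n, hβ, hβn⟩ := gs.exists_conjugator_pre_one y α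
  have hβA : gs.gsup (β⁻¹ * y * β) ≤ -(-gs.gsup y + 1) := by
    rw [hβn]
    have := gs.gsup_conj_zpow_le hΔ (α⁻¹ * y * α) n
    omega
  rw [gs.gsup_conj_le hΔ] at hβA
  obtain ⟨k, hk⟩ := gs.exists_pre_iterate_slideMap (q := -gs.ginf y) hβ hβA (by
    refine (le_or_gt 2 (-gs.ginf y - -gs.gsup y)).imp_right fun h => ?_
    have h' := (gs.le_ginf hΔ).1 (show gs.gsup y - 1 ≤ gs.ginf y by omega)
    rw [← gs.pre_mul_left y⁻¹, ← gs.pre_mul_zpow 1, mul_assoc, ← zpow_add] at h'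
    simpa using h')
  rw [gs.slideMap_inv, ← gs.gsup_conj_le hΔ, gs.conj_iterate_slideMap (γ := 1)] at hk
  · simp only [inv_one, one_mul, mul_one, gs.gsup_iterate_sl_eq hΔ hm hy] at hk
    omega
  · simpa using gs.ginf_iterate_sl_eq hΔ hm hy
  · simpa using gs.gsup_iterate_sl_eq hΔ hm hy

/-- If `y` and `y^β` lie in sliding circuits, then so does `y^(1 ∧ β)`. -/
theorem exists_iterate_sl_conj_one_wedge (hΔ : gs.Δ ≠ 1) {y β : G} {m n : ℕ} (hm : 1 ≤ m)
    (hn : 1 ≤ n) (hy : gs.sl^[m] y = y) (hβ : gs.sl^[n] (β⁻¹ * y * β) = β⁻¹ * y * β) :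
    ∃ N : ℕ, 1 ≤ N ∧ gs.sl^[N] ((gs.wedge 1 β)⁻¹ * y * gs.wedge 1 β) =
      (gs.wedge 1 β)⁻¹ * y * gs.wedge 1 β := by
  set p := gs.ginf y with hp
  set q := gs.gsup y with hq
  set v := β⁻¹ * y * β with hv
  set κ := gs.wedge 1 β with hκ
  have hyp : ∀ k, gs.ginf (gs.sl^[k] y) = p := gs.ginf_iterate_sl_eq hΔ hm hy
  have hyq : ∀ k, gs.gsup (gs.sl^[k] y) = q := gs.gsup_iterate_sl_eq hΔ hm hy
  have hback : y = β⁻¹⁻¹ * v * β⁻¹ := by rw [hv]; group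
  have hp' : gs.ginf v = p := le_antisymm (gs.ginf_conj_le_of_periodic hΔ hm hy β) (by
    rw [hp, hback]; exact gs.ginf_conj_le_of_periodic hΔ hn hβ β⁻¹)
  have hq' : gs.gsup v = q := le_antisymm (by
    rw [hq, hback]; exact gs.le_gsup_conj_of_periodic hΔ hn hβ β⁻¹)
    (gs.le_gsup_conj_of_periodic hΔ hm hy β)
  have hvp : ∀ k, gs.ginf (gs.sl^[k] v) = p := fun k =>
    (gs.ginf_iterate_sl_eq hΔ hn hβ k).trans hp'
  have hvq : ∀ k, gs.gsup (gs.sl^[k] v) = q := fun k =>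
    (gs.gsup_iterate_sl_eq hΔ hn hβ k).trans hq'
  have hκp : p ≤ gs.ginf (κ⁻¹ * y * κ) :=
    gs.le_ginf_conj_wedge hΔ (by simp [hp]) hp'.ge
  have hκq : gs.gsup (κ⁻¹ * y * κ) ≤ q :=
    gs.gsup_conj_wedge_le hΔ (by simp [hq]) hq'.le
  have hκp' : ∀ k, gs.ginf (gs.sl^[k] (κ⁻¹ * y * κ)) = p := by
    intro k
    refine le_antisymm ?_ (hκp.trans (gs.monotone_ginf_iterate_sl hΔ _ (Nat.zero_le k)))
    obtain ⟨c, -, hc⟩ := gs.exists_mem_iterate_sl hΔ (κ⁻¹ * y * κ) k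
    have := gs.ginf_conj_le_of_periodic hΔ hm hy (κ * c)
    rwa [show (κ * c)⁻¹ * y * (κ * c) = c⁻¹ * (κ⁻¹ * y * κ) * c by group, hc] at this
  have hκq' : ∀ k, gs.gsup (gs.sl^[k] (κ⁻¹ * y * κ)) = q := by
    intro k
    refine le_antisymm ((gs.antitone_gsup_iterate_sl hΔ _ (Nat.zero_le k)).trans hκq) ?_
    obtain ⟨c, -, hc⟩ := gs.exists_mem_iterate_sl hΔ (κ⁻¹ * y * κ) k
    have := gs.le_gsup_conj_of_periodic hΔ hm hy (κ * c)
    rwa [show (κ * c)⁻¹ * y * (κ * c) = c⁻¹ * (κ⁻¹ * y * κ) * c by group, hc] at this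
  set M := m * n with hM
  have hM1 : 1 ≤ M := Nat.mul_pos hm hn
  have hyM : gs.sl^[M] y = y := by
    rw [hM, Function.iterate_mul]; exact Function.iterate_fixed hy n
  have hvM : gs.sl^[M] v = v := by
    rw [hM, mul_comm, Function.iterate_mul]; exact Function.iterate_fixed hβ m
  set U := (gs.slideMap y p q)^[M] 1 with hU
  set T : G → G := fun γ => U⁻¹ * (gs.slideMap y p q)^[M] γ with hT
  have hUy : U⁻¹ * y * U = y := by
    have := gs.conj_iterate_slideMap (x := y) (γ := 1) (p := p) (q := q)
      (by simpa using hyp) (by simpa using hyq) M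
    simpa [hyM] using this
  have hTconj : ∀ γ, (∀ k, gs.ginf (gs.sl^[k] (γ⁻¹ * y * γ)) = p) →
      (∀ k, gs.gsup (gs.sl^[k] (γ⁻¹ * y * γ)) = q) →
      (T γ)⁻¹ * y * T γ = gs.sl^[M] (γ⁻¹ * y * γ) := by
    intro γ h h'
    rw [← gs.conj_iterate_slideMap h h' M]
    simp only [hT]
    have : U * y * U⁻¹ = y := by
      conv_lhs => rw [← hUy]
      group
    rw [mul_inv_rev, inv_inv,
      show ∀ a : G, a⁻¹ * U * y * (U⁻¹ * a) = a⁻¹ * (U * y * U⁻¹) * a by intro a; group, this]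
  have hTwedge : ∀ a b, T (gs.wedge a b) = gs.wedge (T a) (T b) := by
    intro a b
    simp only [hT]
    rw [gs.iterate_slideMap_wedge, gs.mul_wedge]
  have hTpow : ∀ r : ℤ, T (gs.Δ ^ r) = gs.Δ ^ r := by
    intro r
    have := gs.iterate_slideMap_mul_zpow y p q r M 1
    rw [one_mul] at this
    simp only [hT]
    rw [this, ← hU, inv_mul_cancel_left]
  have hT1 : T 1 = 1 := by simpa using hTpow 0
  have hTmono : ∀ a b, gs.pre a b → gs.pre (T a) (T b) := by
    intro a b h
    have hab : gs.wedge a b = a :=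
      gs.pre_antisymm (gs.wedge_le_left a b) (gs.le_wedge a b a (gs.pre_refl a) h)
    rw [← hab, hTwedge]
    exact gs.wedge_le_right _ _
  obtain ⟨V, hV⟩ := gs.exists_iterate_slideMap_eq hvp hvq M
  obtain ⟨r, hr, hr'⟩ := gs.exists_zpow_bounds β
  set S : Set G := {γ | γ⁻¹ * y * γ = v ∧
    (gs.pre (gs.Δ ^ (-(r : ℤ))) γ ∧ gs.pre γ (gs.Δ ^ (r : ℤ)))} with hS
  have hSfin : S.Finite := (gs.finite_interval _ _).subset fun γ hγ => hγ.2
  have hTS : Set.MapsTo T S S := by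
    rintro γ ⟨h1, h2, h3⟩
    refine ⟨?_, ?_, ?_⟩
    · rw [hTconj γ (by rwa [h1]) (by rwa [h1]), h1, hvM]
    · rw [← hTpow]; exact hTmono _ _ h2
    · rw [← hTpow r]; exact hTmono _ _ h3
  have hTinj : Set.InjOn T S := by
    rintro a ha b hb hab
    simp only [hT, hV y a ha.1, hV y b hb.1] at hab
    simpa using hab
  have hβS : β ∈ S := ⟨rfl, hr, hr'⟩
  obtain ⟨N, hN, hTN⟩ : ∃ N, 1 ≤ N ∧ T^[N] β = β := by
    have hmem : ∀ k, T^[k] β ∈ S := fun k => hTS.iterate k hβS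
    obtain ⟨i, j, hij, h⟩ : ∃ i j, i < j ∧ T^[i] β = T^[j] β :=
      hSfin.exists_lt_map_eq_of_forall_mem hmem
    refine ⟨j - i, by omega, ?_⟩
    have hinj : Set.InjOn T^[i] S := hTinj.iterate hTS i
    refine (hinj hβS (hmem (j - i)) ?_).symm
    rw [← Function.iterate_add_apply, Nat.add_sub_cancel' hij.le, h]
  have hTκ : ∀ k, T^[k] κ = gs.wedge 1 (T^[k] β) := by
    intro k
    induction k with
    | zero => rfl
    | succ k ih => rw [Function.iterate_succ_apply', ih, hTwedge, hT1, Function.iterate_succ_apply']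
  have hTκconj : ∀ k, (T^[k] κ)⁻¹ * y * T^[k] κ = gs.sl^[M * k] (κ⁻¹ * y * κ) := by
    intro k
    induction k with
    | zero => rfl
    | succ k ih =>
      rw [Function.iterate_succ_apply', hTconj, ih, ← Function.iterate_add_apply, Nat.mul_succ,
        add_comm]
      · intro i
        rw [ih, ← Function.iterate_add_apply, hκp']
      · intro i
        rw [ih, ← Function.iterate_add_apply, hκq']
  refine ⟨M * N, Nat.mul_pos hM1 hN, ?_⟩
  rw [← hTκconj, hTκ, hTN]

theorem conj_wedge_mem_SC (hΔ : gs.Δ ≠ 1) {x α β : G} (hα : α⁻¹ * x * α ∈ gs.SC x)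
    (hβ : β⁻¹ * x * β ∈ gs.SC x) : (gs.wedge α β)⁻¹ * x * gs.wedge α β ∈ gs.SC x := by
  refine ⟨⟨_, rfl⟩, ?_⟩
  obtain ⟨-, m, hm, hm'⟩ := hα
  obtain ⟨-, n, hn, hn'⟩ := hβ
  have hconj : β⁻¹ * x * β = (α⁻¹ * β)⁻¹ * (α⁻¹ * x * α) * (α⁻¹ * β) := by group
  rw [hconj] at hn'
  obtain ⟨N, hN, h⟩ := gs.exists_iterate_sl_conj_one_wedge hΔ hm hn hm' hn'
  refine ⟨N, hN, ?_⟩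
  have hw : gs.wedge α β = α * gs.wedge 1 (α⁻¹ * β) := by
    rw [gs.mul_wedge, mul_one, mul_inv_cancel_left]
  rw [hw]
  convert h using 1 <;> group

theorem exists_mem_conj_mem_SC (hΔ : gs.Δ ≠ 1) (x : G) :
    ∃ c ∈ gs.P, c⁻¹ * x * c ∈ gs.SC x := by
  have hmem : ∀ k, gs.sl^[k] x ∈
      {c | gs.pre (gs.Δ ^ gs.ginf x) c ∧ gs.pre c (gs.Δ ^ gs.gsup x)} := fun k =>
    ⟨(gs.le_ginf hΔ).1 (gs.monotone_ginf_iterate_sl hΔ x (Nat.zero_le k)),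
      (gs.gsup_le hΔ).1 (gs.antitone_gsup_iterate_sl hΔ x (Nat.zero_le k))⟩
  obtain ⟨i, j, hij, h⟩ : ∃ i j, i < j ∧ gs.sl^[i] x = gs.sl^[j] x :=
    (gs.finite_interval _ _).exists_lt_map_eq_of_forall_mem hmem
  obtain ⟨c, hc, hcx⟩ := gs.exists_mem_iterate_sl hΔ x i
  refine ⟨c, hc, ⟨c, rfl⟩, j - i, by omega, ?_⟩
  rw [hcx, ← Function.iterate_add_apply, Nat.sub_add_cancel hij.le, h]

end Sliding

end GarsideStructure

/-- There is a unique `⪯`-minimal positive element conjugating `x` into `SC(x)`. -/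
theorem sc_minimal (gs : GarsideStructure G) (x : G) :
    ∃! c : G, c ∈ gs.P ∧ c⁻¹ * x * c ∈ gs.SC x ∧
      ∀ α : G, α ∈ gs.P → α⁻¹ * x * α ∈ gs.SC x → gs.pre c α := by
  by_cases hΔ : gs.Δ = 1
  · have := gs.subsingleton_of_Δ_eq_one hΔ
    refine ⟨1, ⟨gs.one_mem, ⟨⟨1, rfl⟩, 1, le_rfl, Subsingleton.elim _ _⟩, fun α hα _ => ?_⟩,
      fun _ _ => Subsingleton.elim _ _⟩
    exact gs.pre_one.2 hα
  obtain ⟨a, ha, hax⟩ := gs.exists_mem_conj_mem_SC hΔ x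
  let := gs.semilatticeInf
  set S : Set G := {c | c⁻¹ * x * c ∈ gs.SC x ∧ (gs.pre 1 c ∧ gs.pre c a)} with hS
  have hfin : S.Finite := (gs.finite_interval 1 a).subset fun c hc => hc.2
  obtain ⟨c, hc⟩ := hfin.exists_minimal ⟨a, hax, gs.pre_one.2 ha, gs.pre_refl a⟩
  have hmin : ∀ α : G, α ∈ gs.P → α⁻¹ * x * α ∈ gs.SC x → gs.pre c α := by
    intro α hα hαx
    have hw : gs.wedge c α ∈ S := ⟨gs.conj_wedge_mem_SC hΔ hc.prop.1 hαx,
      gs.le_wedge _ _ _ hc.prop.2.1 (gs.pre_one.2 hα),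
      gs.pre_trans (gs.wedge_le_left c α) hc.prop.2.2⟩
    exact gs.pre_trans (hc.le_of_le hw (gs.wedge_le_left c α)) (gs.wedge_le_right c α)
  have hcP : c ∈ gs.P := gs.pre_one.1 hc.prop.2.1
  refine ⟨c, ⟨hcP, hc.prop.1, hmin⟩, ?_⟩
  rintro d ⟨hd, hdx, hdmin⟩
  exact gs.pre_antisymm (hdmin c hcP hc.prop.1) (hmin d hd hdx)
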